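/- Let A ⊂ ℕ^d be a finite set of exponent vectors whose convex hull Δ has dimension d and which is primitive (the differences a − a′, a, a′ ∈ A, generate ℤ^d as a group), let w = (w_a)_{a∈A} be positive real weights, and set f := Σ_{a∈A} w_a x^a. Then the toric patch of shape (A,w) has rational linear precision if and only if the rational map ψ_{A,w} : ℂ^d ⇢ ℂ^d with coordinates ψ_i := x_i·(∂f/∂x_i)/f is a birational isomorphism, that is, if and only if the subfield ℂ(ψ_1, …, ψ_d) of the rational function field ℂ(x_1, …, x_d) equals the whole field ℂ(x_1, …, x_d). -/

import Mathlib

open MvPolynomial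
open Asymptotics Filter Topology in
lemma poly1_bigO (r : Polynomial ℝ) (n : ℕ)
    (h : (fun t : ℝ => r.eval t) =O[𝓝 0] fun t => t ^ n) : Polynomial.X ^ n ∣ r := by
  induction n with
  | zero => simp
  | succ n ih =>
    have h1 : (fun t : ℝ => r.eval t) =O[𝓝 0] fun t => t ^ n := by
      refine h.trans ?_
      have : (fun t : ℝ => t ^ (n+1)) = fun t => t ^ n * t := by ext; ring
      rw [this]
      have h2 : (fun t : ℝ => t) =O[𝓝 0] (fun _ => (1:ℝ)) :=
        (continuous_id.tendsto (0:ℝ)).isBigO_one ℝ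
      simpa using (isBigO_refl (fun t : ℝ => t ^ n) (𝓝 0)).mul h2
    obtain ⟨s, rfl⟩ := ih h1
    have h3 : (fun t : ℝ => s.eval t) =O[𝓝[≠] 0] fun t => t := by
      have := h.mono (nhdsWithin_le_nhds (s := {0}ᶜ))
      obtain ⟨c, hc⟩ := this.bound
      refine IsBigO.of_bound c ?_
      filter_upwards [hc, self_mem_nhdsWithin] with t ht ht0
      have ht0 : t ≠ 0 := ht0
      simp only [Polynomial.eval_mul, Polynomial.eval_pow, Polynomial.eval_X, norm_mul, norm_pow] at ht
      have : 0 < ‖t‖ ^ n := by positivity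
      rw [pow_succ] at ht
      nlinarith
    have h4 : Tendsto (fun t : ℝ => s.eval t) (𝓝[≠] 0) (𝓝 0) :=
      h3.trans_tendsto (tendsto_id.mono_left nhdsWithin_le_nhds)
    have h5 : Tendsto (fun t : ℝ => s.eval t) (𝓝[≠] 0) (𝓝 (s.eval 0)) :=
      (s.continuous.tendsto 0).mono_left nhdsWithin_le_nhds
    have h6 := tendsto_nhds_unique h5 h4
    have h7 : Polynomial.X ∣ s := by
      rw [Polynomial.X_dvd_iff, Polynomial.coeff_zero_eq_eval_zero, h6]
    rw [pow_succ]
    exact mul_dvd_mul_left _ h7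

open Asymptotics Filter Topology in
lemma polyn_bigO {d : ℕ} (R : MvPolynomial (Fin d) ℝ) (n : ℕ)
    (h : (fun y : Fin d → ℝ => eval y R) =O[𝓝 0] fun y => ‖y‖ ^ n) :
    R ∈ idealOfVars (Fin d) ℝ ^ n := by
  rw [mem_pow_idealOfVars_iff']
  intro x hx
  suffices H : homogeneousComponent x.degree R = 0 by
    have := coeff_homogeneousComponent x.degree R x
    rw [H] at this
    simpa using this.symm
  apply MvPolynomial.funext
  intro y
  rw [map_zero]
  set r : Polynomial ℝ := ∑ k ∈ Finset.range (R.totalDegree + 1),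
    Polynomial.C (eval y (homogeneousComponent k R)) * Polynomial.X ^ k with hr
  have hre : ∀ t, r.eval t = eval (t • y) R := by
    intro t
    conv_rhs => rw [← sum_homogeneousComponent R]
    rw [hr, Polynomial.eval_finsetSum, map_sum]
    refine Finset.sum_congr rfl fun k _ => ?_
    simp only [Polynomial.eval_mul, Polynomial.eval_C, Polynomial.eval_pow, Polynomial.eval_X]
    have hk := homogeneousComponent_isHomogeneous k R
    rw [eval_eq, eval_eq, Finset.sum_mul]
    refine Finset.sum_congr rfl fun m hm => ?_
    have : m.degree = k := by
      have := hk (mem_support_iff.mp hm)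
      rw [Finsupp.degree_eq_weight_one]; exact this
    have h2 : t ^ k = ∏ i ∈ m.support, t ^ (m i) := by
      rw [Finset.prod_pow_eq_pow_sum, ← this]; rfl
    rw [h2, mul_assoc, ← Finset.prod_mul_distrib]
    congr 1
    refine Finset.prod_congr rfl fun i _ => ?_
    simp only [Pi.smul_apply, smul_eq_mul, mul_pow]; ring
  have hO : (fun t : ℝ => r.eval t) =O[𝓝 0] fun t => t ^ n := by
    have ht : Tendsto (fun t : ℝ => t • y) (𝓝 0) (𝓝 0) := by
      have : Continuous (fun t : ℝ => t • y) := by fun_prop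
      simpa using this.tendsto 0
    have := h.comp_tendsto ht
    simp only [Function.comp_def, ← hre] at this
    refine this.trans ?_
    refine IsBigO.of_bound (‖y‖ ^ n) (Eventually.of_forall fun t => ?_)
    rw [norm_smul, mul_pow]; simp [mul_comm]
  have hd := poly1_bigO r n hO
  rw [Polynomial.X_pow_dvd_iff] at hd
  have := hd _ hx
  rw [hr, Polynomial.finsetSum_coeff] at this
  simp only [Polynomial.coeff_C_mul_X_pow] at this
  by_cases hx2 : x.degree ∈ Finset.range (R.totalDegree + 1)
  · rw [Finset.sum_ite_eq] at this
    simpa [hx2] using this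
  · have : R.totalDegree < x.degree := by simpa using hx2
    rw [homogeneousComponent_eq_zero _ _ this, map_zero]

lemma multilinear_poly {d k : ℕ} (m : ContinuousMultilinearMap ℝ (fun _ : Fin k => Fin d → ℝ) ℝ) :
    ∃ T : MvPolynomial (Fin d) ℝ, ∀ y, eval y T = m (fun _ => y) := by
  classical
  refine ⟨∑ r : Fin k → Fin d, C (m fun j => Pi.single (r j) 1) * ∏ j, X (r j), fun y => ?_⟩
  have hy : y = ∑ i, y i • (Pi.single i 1 : Fin d → ℝ) := by
    ext j; simp [Finset.sum_apply, Pi.single_apply]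
  conv_rhs => rw [hy]
  rw [ContinuousMultilinearMap.map_sum]
  simp only [map_sum, map_mul, eval_C, map_prod, eval_X, ContinuousMultilinearMap.map_smul_univ,
    smul_eq_mul]
  exact Finset.sum_congr rfl fun r _ => mul_comm _ _

lemma partialSum_poly {d : ℕ} (p : FormalMultilinearSeries ℝ (Fin d → ℝ) ℝ) (n : ℕ) :
    ∃ T : MvPolynomial (Fin d) ℝ, ∀ y, eval y T = p.partialSum n y := by
  choose T hT using fun k => multilinear_poly (p k)
  exact ⟨∑ k ∈ Finset.range n, T k, fun y => by
    simp [FormalMultilinearSeries.partialSum, hT]⟩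

open Asymptotics Filter Topology in
lemma krull_zero {d : ℕ} (P Q : MvPolynomial (Fin d) ℝ) (φ : (Fin d → ℝ) → ℝ)
    (hφ : AnalyticAt ℝ φ 0) (h : ∀ᶠ y in 𝓝 0, eval y Q * φ y = eval y P) :
    ∃ r : MvPolynomial (Fin d) ℝ, eval 0 r = 0 ∧ Q ∣ (1 - r) * P := by
  obtain ⟨p, hp⟩ := hφ
  have key : ∀ n, ∃ T, P - T * Q ∈ idealOfVars (Fin d) ℝ ^ n := by
    intro n
    obtain ⟨T, hT⟩ := partialSum_poly p n
    refine ⟨T, polyn_bigO _ n ?_⟩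
    have h1 := hp.isBigO_sub_partialSum_pow n
    have h2 : (fun y : Fin d → ℝ => eval y Q) =O[𝓝 0] (fun _ => (1:ℝ)) :=
      ((MvPolynomial.continuous_eval Q).tendsto 0).isBigO_one ℝ
    have h3 := h2.mul h1
    simp only [one_mul] at h3
    refine h3.congr' ?_ EventuallyEq.rfl
    filter_upwards [h] with y hy
    simp only [map_sub, map_mul, hT, zero_add, ← hy]; ring
  have hm := (Ideal.mem_iInf_smul_pow_eq_bot_iff (idealOfVars (Fin d) ℝ)
    (Ideal.Quotient.mk (Ideal.span {Q}) P)).1 (by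
      rw [Submodule.mem_iInf]
      intro n
      obtain ⟨T, hT⟩ := key n
      have : Ideal.Quotient.mk (Ideal.span {Q}) P = (P - T * Q) • (1 : _ ⧸ Ideal.span {Q}) := by
        change _ = Ideal.Quotient.mk (Ideal.span {Q}) ((P - T * Q) * 1)
        rw [mul_one, Ideal.Quotient.eq, Ideal.mem_span_singleton]
        exact ⟨T, by ring⟩
      rw [this]
      exact Submodule.smul_mem_smul hT trivial)
  obtain ⟨⟨r, hr⟩, hr2⟩ := hm
  refine ⟨r, ?_, ?_⟩
  · have : idealOfVars (Fin d) ℝ ≤ RingHom.ker (eval (0 : Fin d → ℝ)) := by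
      rw [Ideal.span_le]; rintro _ ⟨i, rfl⟩; simp [RingHom.mem_ker]
    exact this hr
  · simp only at hr2
    change Ideal.Quotient.mk (Ideal.span {Q}) (r * P) = _ at hr2
    rw [Ideal.Quotient.eq, Ideal.mem_span_singleton] at hr2
    have := hr2.neg_right
    convert this using 1; ring

lemma krull_pt {d : ℕ} (P Q : MvPolynomial (Fin d) ℝ) (φ : (Fin d → ℝ) → ℝ) (y₀ : Fin d → ℝ)
    (hφ : AnalyticAt ℝ φ y₀) (h : ∀ᶠ y in nhds y₀, eval y Q * φ y = eval y P) :
    ∃ r : MvPolynomial (Fin d) ℝ, eval y₀ r = 0 ∧ Q ∣ (1 - r) * P := by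
  let τ : MvPolynomial (Fin d) ℝ →ₐ[ℝ] MvPolynomial (Fin d) ℝ := aeval fun i => X i + C (y₀ i)
  let τ' : MvPolynomial (Fin d) ℝ →ₐ[ℝ] MvPolynomial (Fin d) ℝ := aeval fun i => X i - C (y₀ i)
  have hττ : ∀ R, τ' (τ R) = R := by
    intro R
    have : τ'.comp τ = AlgHom.id ℝ _ := by
      apply MvPolynomial.algHom_ext; intro i; simp [τ, τ', ← MvPolynomial.algebraMap_eq]
    exact DFunLike.congr_fun this R
  have hτ : ∀ R y, eval y (τ R) = eval (y + y₀) R := by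
    intro R y
    have : (aeval y : _ →ₐ[ℝ] ℝ).comp τ = aeval (y + y₀) := by
      apply MvPolynomial.algHom_ext; intro i; simp [τ]
    simpa [MvPolynomial.coe_aeval_eq_eval] using DFunLike.congr_fun this R
  have hτ' : ∀ R y, eval y (τ' R) = eval (y - y₀) R := by
    intro R y
    have : (aeval y : _ →ₐ[ℝ] ℝ).comp τ' = aeval (y - y₀) := by
      apply MvPolynomial.algHom_ext; intro i; simp [τ']
    simpa [MvPolynomial.coe_aeval_eq_eval] using DFunLike.congr_fun this R
  have hc : Filter.Tendsto (fun y : Fin d → ℝ => y + y₀) (nhds 0) (nhds y₀) := by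
    have : Continuous (fun y : Fin d → ℝ => y + y₀) := by fun_prop
    simpa using this.tendsto 0
  obtain ⟨r, hr, hdvd⟩ := krull_zero (τ P) (τ Q) (fun y => φ (y + y₀))
    (AnalyticAt.fun_comp (f := fun y : Fin d → ℝ => y + y₀) (by simpa using hφ) (by fun_prop))
    (by
      filter_upwards [hc.eventually h] with y hy
      rw [hτ, hτ]; exact hy)
  refine ⟨τ' r, by rw [hτ', sub_self, hr], ?_⟩
  have := map_dvd τ' hdvd
  simpa [hττ] using this

lemma frequently_ne_zero {d : ℕ} (c : MvPolynomial (Fin d) ℝ) (hc : c ≠ 0) (y₀ : Fin d → ℝ) :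
    ∃ᶠ y in nhds y₀, eval y c ≠ 0 := by
  intro h
  apply hc
  simp only [not_not] at h
  obtain ⟨ε, hε, hb⟩ := Metric.eventually_nhds_iff_ball.1 h
  refine MvPolynomial.funext_set (fun i => Metric.ball (y₀ i) ε) (fun i => ?_) ?_
  · rw [Real.ball_eq_Ioo]; exact Set.Ioo_infinite (by linarith)
  · intro x hx
    rw [map_zero]; exact hb x (by rw [ball_pi _ hε]; exact hx)

/-- reduced fractions representing an analytic function have nonvanishing denominator -/
lemma reduced_pt {d : ℕ} (p q c : MvPolynomial (Fin d) ℝ) (hrel : IsRelPrime q p)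
    (hc : c ≠ 0) (φ : (Fin d → ℝ) → ℝ) (y₀ : Fin d → ℝ)
    (hφ : AnalyticAt ℝ φ y₀)
    (h : ∀ᶠ y in nhds y₀, eval y (c * q) * φ y = eval y (c * p)) :
    eval y₀ q ≠ 0 ∧ eval y₀ q * φ y₀ = eval y₀ p := by
  constructor
  · obtain ⟨r, hr, hd⟩ := krull_pt (c * p) (c * q) φ y₀ hφ h
    have h1 : q ∣ (1 - r) * p := by
      have : c * q ∣ c * ((1 - r) * p) := by convert hd using 1; ring
      exact (mul_dvd_mul_iff_left hc).1 this
    obtain ⟨k, hk⟩ := hrel.dvd_of_dvd_mul_right h1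
    have := congrArg (eval y₀) hk
    simp only [map_sub, map_one, hr, map_mul] at this
    intro h0; simp [h0] at this
  · by_contra hne
    have hcont : ContinuousAt (fun y => eval y q * φ y - eval y p) y₀ :=
      ((MvPolynomial.continuous_eval q).continuousAt.mul hφ.continuousAt).sub
        (MvPolynomial.continuous_eval p).continuousAt
    have h2 := hcont.eventually_ne (sub_ne_zero.2 hne)
    obtain ⟨y, hy, hy2, hy3⟩ := ((frequently_ne_zero c hc y₀).and_eventually (h2.and h)).exists
    apply hy2
    simp only [map_mul] at hy3
    have : eval y c * (eval y q * φ y - eval y p) = 0 := by linear_combination hy3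
    exact (mul_eq_zero.1 this).resolve_left hy
noncomputable def tW {d : ℕ} (w : (Fin d → ℕ) → ℝ) (u : Fin d → ℝ) (a : Fin d → ℕ) : ℝ :=
  w a * Real.exp (∑ i, (a i : ℝ) * u i)

noncomputable def tZ {d : ℕ} (A : Finset (Fin d → ℕ)) (w : (Fin d → ℕ) → ℝ) (u : Fin d → ℝ) : ℝ :=
  ∑ a ∈ A, tW w u a

noncomputable def tΨ {d : ℕ} (A : Finset (Fin d → ℕ)) (w : (Fin d → ℕ) → ℝ) (u : Fin d → ℝ) :
    Fin d → ℝ := fun i => (∑ a ∈ A, (a i : ℝ) * tW w u a) / tZ A w u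

lemma A_nonempty {d : ℕ} {A : Finset (Fin d → ℕ)}
    (hdim : affineSpan ℝ ((fun a : Fin d → ℕ => fun i => (a i : ℝ)) '' (A : Set (Fin d → ℕ))) = ⊤) :
    A.Nonempty := by
  rw [Finset.nonempty_iff_ne_empty]
  rintro rfl
  simp only [Finset.coe_empty, Set.image_empty, AffineSubspace.span_empty] at hdim
  exact AffineSubspace.bot_ne_top ℝ _ _ hdim

lemma tW_pos {d : ℕ} {A : Finset (Fin d → ℕ)} {w : (Fin d → ℕ) → ℝ} (hw : ∀ a ∈ A, 0 < w a)
    (u : Fin d → ℝ) : ∀ a ∈ A, 0 < tW w u a := fun a ha =>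
  mul_pos (hw a ha) (Real.exp_pos _)

lemma tZ_pos {d : ℕ} {A : Finset (Fin d → ℕ)} {w : (Fin d → ℕ) → ℝ} (hA : A.Nonempty)
    (hw : ∀ a ∈ A, 0 < w a) (u : Fin d → ℝ) : 0 < tZ A w u :=
  Finset.sum_pos (tW_pos hw u) hA

/-- a linear form constant on `A` vanishes -/
lemma form_zero {d : ℕ} {A : Finset (Fin d → ℕ)}
    (hdim : affineSpan ℝ ((fun a : Fin d → ℕ => fun i => (a i : ℝ)) '' (A : Set (Fin d → ℕ))) = ⊤)
    (v : Fin d → ℝ)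
    (h : ∀ a ∈ A, ∀ b ∈ A, ∑ i, (a i : ℝ) * v i = ∑ i, (b i : ℝ) * v i) : v = 0 := by
  obtain ⟨b, hb⟩ := A_nonempty hdim
  let L : (Fin d → ℝ) →ₗ[ℝ] ℝ := ∑ i, v i • LinearMap.proj i
  have hL : ∀ x, L x = ∑ i, x i * v i := by
    intro x; simp [L, mul_comm]
  have hEq : ∀ x : Fin d → ℝ, L x = L (fun i => (b i : ℝ)) := by
    intro x
    have hx : x ∈ affineSpan ℝ ((fun a : Fin d → ℕ => fun i => (a i : ℝ)) '' (A : Set (Fin d → ℕ))) := by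
      rw [hdim]; trivial
    refine affineSpan_induction (p := fun x => L x = L (fun i => (b i : ℝ))) hx ?_ ?_
    · rintro _ ⟨a, ha, rfl⟩
      rw [hL, hL]; exact h a ha b hb
    · intro c u v w hu hv hw
      simp [map_add, map_smul, map_sub, hu, hv, hw]
  have h0 := hEq 0
  rw [map_zero] at h0
  have h1 := hEq v
  rw [← h0, hL] at h1
  funext i
  have := (Finset.sum_eq_zero_iff_of_nonneg (fun i _ => mul_self_nonneg (v i))).1 h1 i (Finset.mem_univ i)
  exact mul_self_eq_zero.1 this

/-- Chebyshev's sum identity, equality case -/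
lemma cheb {α : Type*} (A : Finset α) (W c g : α → ℝ) (hW : ∀ a ∈ A, 0 < W a)
    (hcg : ∀ a b, c a ≠ c b → 0 < (c a - c b) * (g a - g b))
    (h : (∑ a ∈ A, c a * g a * W a) * (∑ a ∈ A, W a) = (∑ a ∈ A, c a * W a) * ∑ a ∈ A, g a * W a) :
    ∀ a ∈ A, ∀ b ∈ A, c a = c b := by
  have hn : ∀ a b, 0 ≤ (c a - c b) * (g a - g b) := by
    intro a b
    by_cases hc : c a = c b
    · simp [hc]
    · exact (hcg a b hc).le
  have e : ∑ a ∈ A, ∑ b ∈ A, W a * W b * ((c a - c b) * (g a - g b)) = 0 := by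
    have : ∀ a b, W a * W b * ((c a - c b) * (g a - g b)) =
      (c a * g a * W a) * W b - (c a * W a) * (g b * W b) - (g a * W a) * (c b * W b)
        + W a * (c b * g b * W b) := by intros; ring
    simp only [this, Finset.sum_add_distrib, Finset.sum_sub_distrib, ← Finset.sum_mul_sum]
    linear_combination 2 * h
  intro a ha b hb
  by_contra hc
  have h1 := (Finset.sum_eq_zero_iff_of_nonneg (fun a ha => Finset.sum_nonneg fun b hb =>
    mul_nonneg (mul_pos (hW a ha) (hW b hb)).le (hn a b))).1 e a ha
  have h2 := (Finset.sum_eq_zero_iff_of_nonneg (fun b hb =>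
    mul_nonneg (mul_pos (hW a ha) (hW b hb)).le (hn a b))).1 h1 b hb
  have := mul_pos (mul_pos (hW a ha) (hW b hb)) (hcg a b hc)
  linarith

/-- pairing of the moment sum with a vector -/
lemma sum_pair {d : ℕ} {A : Finset (Fin d → ℕ)} (W : (Fin d → ℕ) → ℝ) (v : Fin d → ℝ) :
    ∑ i, (∑ a ∈ A, (a i : ℝ) * W a) * v i = ∑ a ∈ A, (∑ i, (a i : ℝ) * v i) * W a := by
  simp only [Finset.sum_mul]
  rw [Finset.sum_comm]
  refine Finset.sum_congr rfl fun a _ => Finset.sum_congr rfl fun i _ => by ring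

lemma tΨ_injective {d : ℕ} {A : Finset (Fin d → ℕ)} {w : (Fin d → ℕ) → ℝ}
    (hdim : affineSpan ℝ ((fun a : Fin d → ℕ => fun i => (a i : ℝ)) '' (A : Set (Fin d → ℕ))) = ⊤)
    (hw : ∀ a ∈ A, 0 < w a)
    : Function.Injective (tΨ A w) := by
  intro u v huv
  have hZu := tZ_pos (A_nonempty hdim) hw u
  have hZv := tZ_pos (A_nonempty hdim) hw v
  suffices h : v - u = 0 from (sub_eq_zero.1 h).symm
  apply form_zero hdim
  set c : (Fin d → ℕ) → ℝ := fun a => ∑ i, (a i : ℝ) * (v - u) i with hc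
  refine cheb A (tW w u) c (fun a => Real.exp (c a)) (tW_pos hw u) ?_ ?_
  · intro a b hab
    rcases lt_or_gt_of_ne hab with h | h
    · have := Real.exp_lt_exp.2 h
      exact mul_pos_of_neg_of_neg (by linarith) (by linarith)
    · have := Real.exp_lt_exp.2 h
      exact mul_pos (by linarith) (by linarith)
  · have hWv : ∀ a, Real.exp (c a) * tW w u a = tW w v a := by
      intro a
      simp only [tW, hc]
      rw [mul_left_comm, ← Real.exp_add, ← Finset.sum_add_distrib]
      congr 2
      exact Finset.sum_congr rfl fun i _ => by simp only [Pi.sub_apply]; ring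
    have h1 : ∑ i, tΨ A w u i * (v - u) i = ∑ i, tΨ A w v i * (v - u) i := by rw [huv]
    simp only [tΨ, div_mul_eq_mul_div, ← Finset.sum_div] at h1
    rw [sum_pair, sum_pair, div_eq_div_iff hZu.ne' hZv.ne'] at h1
    simp only [mul_assoc, hWv]
    exact h1.symm

lemma tΨ_contDiff {d : ℕ} {A : Finset (Fin d → ℕ)} {w : (Fin d → ℕ) → ℝ}
    (hdim : affineSpan ℝ ((fun a : Fin d → ℕ => fun i => (a i : ℝ)) '' (A : Set (Fin d → ℕ))) = ⊤)
    (hw : ∀ a ∈ A, 0 < w a)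
    : ContDiff ℝ ⊤ (tΨ A w) := by
  have hW : ∀ a, ContDiff ℝ ⊤ (fun u => tW w u a) := by
    intro a; unfold tW; fun_prop
  rw [contDiff_pi]
  intro i
  unfold tΨ
  refine ContDiff.div ?_ ?_ (fun u => (tZ_pos (A_nonempty hdim) hw u).ne')
  · exact ContDiff.sum fun a _ => contDiff_const.mul (hW a)
  · exact ContDiff.sum fun a _ => hW a

lemma tΨ_equiv {d : ℕ} {A : Finset (Fin d → ℕ)} {w : (Fin d → ℕ) → ℝ}
    (hdim : affineSpan ℝ ((fun a : Fin d → ℕ => fun i => (a i : ℝ)) '' (A : Set (Fin d → ℕ))) = ⊤)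
    (hw : ∀ a ∈ A, 0 < w a)
    (u : Fin d → ℝ) : ∃ f' : (Fin d → ℝ) ≃L[ℝ] (Fin d → ℝ),
    HasFDerivAt (tΨ A w) (f' : (Fin d → ℝ) →L[ℝ] (Fin d → ℝ)) u := by
  have hd : HasFDerivAt (tΨ A w) (fderiv ℝ (tΨ A w) u) u :=
    ((tΨ_contDiff hdim hw).differentiable (by simp) u).hasFDerivAt
  have hinj : Function.Injective (fderiv ℝ (tΨ A w) u : (Fin d → ℝ) →ₗ[ℝ] (Fin d → ℝ)) := by
    rw [injective_iff_map_eq_zero]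
    intro v hv
    replace hv : fderiv ℝ (tΨ A w) u v = 0 := hv
    apply form_zero hdim
    set c : (Fin d → ℕ) → ℝ := fun a => ∑ i, (a i : ℝ) * v i with hc
    refine cheb A (tW w u) c c (tW_pos hw u) ?_ ?_
    · intro a b hab
      exact mul_self_pos.2 (sub_ne_zero.2 hab)
    · have hline : HasDerivAt (fun t : ℝ => u + t • v) v 0 := by
        simpa using ((hasDerivAt_id (0:ℝ)).smul_const v).const_add u
      have h1 : HasDerivAt (fun t : ℝ => tΨ A w (u + t • v)) 0 0 := by
        have hd' : HasFDerivAt (tΨ A w) (fderiv ℝ (tΨ A w) u) (u + (0:ℝ) • v) := by simpa using hd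
        have := hd'.comp_hasDerivAt (0:ℝ) hline
        rw [hv] at this; exact this
      have hWt : ∀ a, HasDerivAt (fun t : ℝ => tW w (u + t • v) a) (c a * tW w u a) 0 := by
        intro a
        unfold tW
        have hs : HasDerivAt (fun t : ℝ => ∑ i, (a i : ℝ) * (u + t • v) i) (c a) 0 := by
          refine HasDerivAt.fun_sum fun i _ => ?_
          exact ((hasDerivAt_pi.1 hline) i).const_mul _
        have := (hs.exp).const_mul (w a)
        simp only [zero_smul, add_zero] at this
        have e : c a * (w a * Real.exp (∑ i, (a i : ℝ) * u i)) =
            w a * (Real.exp (∑ i, (a i : ℝ) * u i) * c a) := by ring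
        rw [e]; exact this
      have hZt : HasDerivAt (fun t : ℝ => tZ A w (u + t • v)) (∑ a ∈ A, c a * tW w u a) 0 :=
        HasDerivAt.fun_sum fun a _ => hWt a
      have hNt : HasDerivAt (fun t : ℝ => ∑ a ∈ A, c a * tW w (u + t • v) a)
          (∑ a ∈ A, c a * (c a * tW w u a)) 0 :=
        HasDerivAt.fun_sum fun a _ => (hWt a).const_mul _
      have hZu := tZ_pos (A_nonempty hdim) hw u
      have hq := hNt.div hZt (by simpa using hZu.ne')
      have hz : HasDerivAt (fun t : ℝ => ∑ i, tΨ A w (u + t • v) i * v i) 0 0 := by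
        have : HasDerivAt (fun t : ℝ => ∑ i, tΨ A w (u + t • v) i * v i)
            (∑ i, (0 : Fin d → ℝ) i * v i) 0 :=
          HasDerivAt.fun_sum fun i _ => ((hasDerivAt_pi.1 h1) i).mul_const _
        simpa using this
      have hfe : (fun t : ℝ => ∑ i, tΨ A w (u + t • v) i * v i) =
          fun t => (∑ a ∈ A, c a * tW w (u + t • v) a) / tZ A w (u + t • v) := by
        funext t
        simp only [tΨ, div_mul_eq_mul_div, ← Finset.sum_div]
        rw [sum_pair]
      rw [hfe] at hz
      have hu := hz.unique hq
      simp only [zero_smul, add_zero] at hu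
      have h3 := (div_eq_zero_iff.1 hu.symm).resolve_right (pow_ne_zero 2 hZu.ne')
      simp only [mul_assoc]
      exact sub_eq_zero.1 h3
  refine ⟨(LinearEquiv.ofInjectiveEndo _ hinj).toContinuousLinearEquiv, ?_⟩
  convert hd using 1
  ext v : 1
  rfl

lemma tΨ_mem_interior {d : ℕ} {A : Finset (Fin d → ℕ)} {w : (Fin d → ℕ) → ℝ}
    (hdim : affineSpan ℝ ((fun a : Fin d → ℕ => fun i => (a i : ℝ)) '' (A : Set (Fin d → ℕ))) = ⊤)
    (hw : ∀ a ∈ A, 0 < w a)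
    (u : Fin d → ℝ) : tΨ A w u ∈ interior (convexHull ℝ
    ((fun a : Fin d → ℕ => fun i => (a i : ℝ)) '' (A : Set (Fin d → ℕ)))) := by
  rw [mem_interior_iff_mem_nhds]
  obtain ⟨f', hf'⟩ := tΨ_equiv hdim hw u
  have hs := (tΨ_contDiff hdim hw).contDiffAt.hasStrictFDerivAt' hf' (by simp)
  rw [← hs.map_nhds_eq_of_equiv]
  refine Filter.mem_map.2 (Filter.univ_mem' fun v => ?_)
  rw [Set.mem_preimage]
  have hZ := tZ_pos (A_nonempty hdim) hw v
  have : tΨ A w v = A.centerMass (tW w v) (fun a i => (a i : ℝ)) := by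
    funext i
    simp only [tΨ, Finset.centerMass, Pi.smul_apply, Finset.sum_apply, smul_eq_mul, tZ]
    rw [div_eq_inv_mul]
    congr 1
    exact Finset.sum_congr rfl fun a _ => mul_comm _ _
  rw [this]
  exact Finset.centerMass_mem_convexHull A (fun a ha => (tW_pos hw v a ha).le) hZ
    fun a ha => ⟨a, ha, rfl⟩

lemma tΨ_eq_iff {d : ℕ} {A : Finset (Fin d → ℕ)} {w : (Fin d → ℕ) → ℝ}
    (hdim : affineSpan ℝ ((fun a : Fin d → ℕ => fun i => (a i : ℝ)) '' (A : Set (Fin d → ℕ))) = ⊤)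
    (hw : ∀ a ∈ A, 0 < w a)
    (u y : Fin d → ℝ) :
    tΨ A w u = y ↔ ∀ i, ∑ a ∈ A, tW w u a * ((a i : ℝ) - y i) = 0 := by
  have hZ := tZ_pos (A_nonempty hdim) hw u
  rw [funext_iff]
  refine forall_congr' fun i => ?_
  simp only [tΨ]
  rw [div_eq_iff hZ.ne', tZ, Finset.mul_sum, ← sub_eq_zero, ← Finset.sum_sub_distrib]
  have : ∀ a : Fin d → ℕ, (a i : ℝ) * tW w u a - y i * tW w u a = tW w u a * ((a i : ℝ) - y i) := by
    intro a; ring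
  simp only [this]

lemma tΨ_surj {d : ℕ} {A : Finset (Fin d → ℕ)} {w : (Fin d → ℕ) → ℝ}
    (hdim : affineSpan ℝ ((fun a : Fin d → ℕ => fun i => (a i : ℝ)) '' (A : Set (Fin d → ℕ))) = ⊤)
    (hw : ∀ a ∈ A, 0 < w a)
    (y : Fin d → ℝ) (hy : y ∈ interior (convexHull ℝ
    ((fun a : Fin d → ℕ => fun i => (a i : ℝ)) '' (A : Set (Fin d → ℕ))))) :
    ∃ u, tΨ A w u = y := by
  have hA := A_nonempty hdim
  obtain ⟨ε, hε, hball⟩ := Metric.isOpen_iff.1 isOpen_interior y hy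
  set G : (Fin d → ℝ) → ℝ := fun u => ∑ a ∈ A, w a * Real.exp (∑ i, ((a i : ℝ) - y i) * u i) with hG
  have hGc : Continuous G := by
    rw [hG]; fun_prop
  obtain ⟨a₀, ha₀, hmin⟩ := A.exists_min_image w hA
  have hlow : ∀ u, w a₀ * (ε / 2 * ‖u‖) ≤ G u := by
    intro u
    set s : Fin d → ℝ := fun i => ε / 2 * SignType.sign (u i) with hs
    have hmem : y + s ∈ convexHull ℝ
        ((fun a : Fin d → ℕ => fun i => (a i : ℝ)) '' (A : Set (Fin d → ℕ))) := by
      apply interior_subset; apply hball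
      rw [Metric.mem_ball, dist_eq_norm, add_sub_cancel_left]
      refine lt_of_le_of_lt ((pi_norm_le_iff_of_nonneg (by positivity : 0 ≤ ε / 2)).2 fun i => ?_)
        (half_lt_self hε)
      rw [hs, norm_mul, Real.norm_of_nonneg (by positivity : 0 ≤ ε / 2)]
      have : ‖((SignType.sign (u i) : SignType) : ℝ)‖ ≤ 1 := by
        rcases lt_trichotomy (u i) 0 with h | h | h <;> simp [h]
      nlinarith
    let L : (Fin d → ℝ) →ₗ[ℝ] ℝ := ∑ i, u i • LinearMap.proj i
    have hL : ∀ x, L x = ∑ i, x i * u i := by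
      intro x; simp [L, mul_comm]
    obtain ⟨_, ⟨a, ha, rfl⟩, hle⟩ := (L.convexOn convex_univ).exists_ge_of_mem_convexHull
      (Set.subset_univ _) hmem
    rw [hL, hL] at hle
    have h1 : ε / 2 * ‖u‖ ≤ ∑ i, ((a i : ℝ) - y i) * u i := by
      have h2 : ∑ i, s i * u i ≤ ∑ i, ((a i : ℝ) - y i) * u i := by
        simp only [Pi.add_apply, add_mul, Finset.sum_add_distrib] at hle
        simp only [sub_mul, Finset.sum_sub_distrib]
        linarith
      refine le_trans ?_ h2
      have h3 : ∀ i, s i * u i = ε / 2 * |u i| := by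
        intro i; rw [hs]; simp only; rw [mul_assoc, sign_mul_self]
      simp only [h3, ← Finset.mul_sum]
      refine mul_le_mul_of_nonneg_left ?_ (by positivity)
      refine (pi_norm_le_iff_of_nonneg (Finset.sum_nonneg fun i _ => abs_nonneg _)).2 fun i => ?_
      exact Finset.single_le_sum (f := fun i => |u i|) (fun i _ => abs_nonneg _) (Finset.mem_univ i)
    have h4 : w a * Real.exp (∑ i, ((a i : ℝ) - y i) * u i) ≤ G u :=
      Finset.single_le_sum (f := fun a : Fin d → ℕ => w a * Real.exp (∑ i, ((a i : ℝ) - y i) * u i))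
        (fun a ha => (mul_pos (hw a ha) (Real.exp_pos _)).le) ha
    refine le_trans ?_ h4
    have h5 := Real.add_one_le_exp (∑ i, ((a i : ℝ) - y i) * u i)
    refine mul_le_mul (hmin a ha) (by linarith) (by positivity) (hw a ha).le
  have hw0 := hw a₀ ha₀
  have hco : Filter.Tendsto G (Filter.cocompact _) Filter.atTop := by
    refine Filter.tendsto_atTop_mono hlow ?_
    have : Filter.Tendsto (fun u : Fin d → ℝ => ‖u‖) (Filter.cocompact _) Filter.atTop :=
      tendsto_norm_cocompact_atTop
    exact (this.const_mul_atTop (by positivity : 0 < ε / 2)).const_mul_atTop hw0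
  obtain ⟨u, hu⟩ := hGc.exists_forall_le hco
  refine ⟨u, (tΨ_eq_iff hdim hw u y).2 fun i => ?_⟩
  have hline : HasDerivAt (fun t : ℝ => u + t • (Pi.single i 1 : Fin d → ℝ)) (Pi.single i 1) 0 := by
    simpa using ((hasDerivAt_id (0:ℝ)).smul_const (Pi.single i 1 : Fin d → ℝ)).const_add u
  have hder : HasDerivAt (fun t : ℝ => G (u + t • (Pi.single i 1 : Fin d → ℝ)))
      (∑ a ∈ A, w a * (Real.exp (∑ j, ((a j : ℝ) - y j) * u j) * ((a i : ℝ) - y i))) 0 := by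
    refine HasDerivAt.fun_sum fun a _ => ?_
    have hs : HasDerivAt (fun t : ℝ => ∑ j, ((a j : ℝ) - y j) *
        (u + t • (Pi.single i 1 : Fin d → ℝ)) j) (∑ j, ((a j : ℝ) - y j) * (Pi.single i 1 : Fin d → ℝ) j) 0 :=
      HasDerivAt.fun_sum fun j _ => ((hasDerivAt_pi.1 hline) j).const_mul _
    have := (hs.exp).const_mul (w a)
    simpa [Pi.single_apply] using this
  have hloc : IsLocalMin (fun t : ℝ => G (u + t • (Pi.single i 1 : Fin d → ℝ))) 0 :=
    Filter.Eventually.of_forall fun t => by simpa using hu _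
  have h0 := hloc.hasDerivAt_eq_zero hder
  have hsplit : ∀ a : Fin d → ℕ, tW w u a * ((a i : ℝ) - y i) = Real.exp (∑ j, y j * u j) *
      (w a * (Real.exp (∑ j, ((a j : ℝ) - y j) * u j) * ((a i : ℝ) - y i))) := by
    intro a
    have : Real.exp (∑ j, (a j : ℝ) * u j) = Real.exp (∑ j, y j * u j) *
        Real.exp (∑ j, ((a j : ℝ) - y j) * u j) := by
      rw [← Real.exp_add, ← Finset.sum_add_distrib]
      congr 1
      exact Finset.sum_congr rfl fun j _ => by ring
    rw [tW, this]; ring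
  simp only [hsplit, ← Finset.mul_sum, h0, mul_zero]

/-- local analytic inverse -/
lemma tΨ_localInverse {d : ℕ} {A : Finset (Fin d → ℕ)} {w : (Fin d → ℕ) → ℝ}
    (hdim : affineSpan ℝ ((fun a : Fin d → ℕ => fun i => (a i : ℝ)) '' (A : Set (Fin d → ℕ))) = ⊤)
    (hw : ∀ a ∈ A, 0 < w a)
    (u : Fin d → ℝ) : ∃ φ : (Fin d → ℝ) → (Fin d → ℝ),
    (∀ i, AnalyticAt ℝ (fun y => Real.exp (φ y i)) (tΨ A w u)) ∧ φ (tΨ A w u) = u ∧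
    ∀ᶠ y in nhds (tΨ A w u), tΨ A w (φ y) = y := by
  obtain ⟨f', hf'⟩ := tΨ_equiv hdim hw u
  have hc : ContDiffAt ℝ ⊤ (tΨ A w) u := (tΨ_contDiff hdim hw).contDiffAt
  have hn : (⊤ : WithTop ℕ∞) ≠ 0 := by simp
  refine ⟨hc.localInverse hf' hn, fun i => ?_, hc.localInverse_apply_image hf' hn,
    (hc.hasStrictFDerivAt' hf' hn).eventually_right_inverse⟩
  have h1 := hc.to_localInverse hf' hn
  have h2 : ContDiffAt ℝ ⊤ (fun y => Real.exp (hc.localInverse hf' hn y i)) (tΨ A w u) :=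
    ((contDiffAt_pi.1 h1) i).exp
  exact h2.analyticAt
/-- clearing denominators in a polynomial expression of fractions with common denominator -/
lemma clear_denoms {d : ℕ} (F : MvPolynomial (Fin d) ℂ) (N : Fin d → MvPolynomial (Fin d) ℂ)
    (hF : F ≠ 0) (ψ : Fin d → FractionRing (MvPolynomial (Fin d) ℂ))
    (hψ : ∀ i, ψ i = algebraMap _ (FractionRing (MvPolynomial (Fin d) ℂ)) (N i) /
      algebraMap _ (FractionRing (MvPolynomial (Fin d) ℂ)) F)
    (P : MvPolynomial (Fin d) ℂ) :
    ∃ (n : ℕ) (R : MvPolynomial (Fin d) ℂ),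
      algebraMap _ (FractionRing (MvPolynomial (Fin d) ℂ)) R =
        algebraMap _ (FractionRing (MvPolynomial (Fin d) ℂ)) F ^ n * aeval ψ P ∧
      ∀ z, eval z F ≠ 0 → eval z R =
        eval z F ^ n * eval (fun i => eval z (N i) / eval z F) P := by
  have hF' : algebraMap _ (FractionRing (MvPolynomial (Fin d) ℂ)) F ≠ 0 := by
    rwa [Ne, IsFractionRing.to_map_eq_zero_iff]
  induction P using MvPolynomial.induction_on with
  | C a =>
    refine ⟨0, C a, ?_, fun z _ => by simp⟩
    rw [pow_zero, one_mul, aeval_C, ← MvPolynomial.algebraMap_eq,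
      ← IsScalarTower.algebraMap_apply]
  | add p q hp hq =>
    obtain ⟨n, R, h1, h2⟩ := hp
    obtain ⟨m, S, h3, h4⟩ := hq
    refine ⟨n + m, R * F ^ m + S * F ^ n, ?_, fun z hz => ?_⟩
    · simp only [map_add, map_mul, map_pow, h1, h3]; ring
    · simp only [map_add, map_mul, map_pow, h2 z hz, h4 z hz]; ring
  | mul_X p i hp =>
    obtain ⟨n, R, h1, h2⟩ := hp
    refine ⟨n + 1, R * N i, ?_, fun z hz => ?_⟩
    · simp only [map_mul, h1, aeval_X, hψ i]; field_simp; ring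
    · simp only [map_mul, h2 z hz, eval_X]; field_simp; ring

lemma complex_split {d : ℕ} (P : MvPolynomial (Fin d) ℂ) :
    ∃ P₁ P₂ : MvPolynomial (Fin d) ℝ,
      P = map Complex.ofRealHom P₁ + C Complex.I * map Complex.ofRealHom P₂ := by
  induction P using MvPolynomial.induction_on with
  | C a =>
    refine ⟨C a.re, C a.im, ?_⟩
    simp only [map_C, ← map_mul, ← map_add]
    congr 1
    simp only [Complex.ofRealHom_eq_coe]
    rw [mul_comm]; exact (Complex.re_add_im a).symm
  | add p q hp hq =>
    obtain ⟨a, b, rfl⟩ := hp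
    obtain ⟨a', b', rfl⟩ := hq
    exact ⟨a + a', b + b', by simp only [map_add]; ring⟩
  | mul_X p i hp =>
    obtain ⟨a, b, rfl⟩ := hp
    exact ⟨a * X i, b * X i, by simp only [map_mul, map_X]; ring⟩

lemma eval_map_ofReal {d : ℕ} (P : MvPolynomial (Fin d) ℝ) (y : Fin d → ℝ) :
    eval (fun i => (y i : ℂ)) (map Complex.ofRealHom P) = ((eval y P : ℝ) : ℂ) := by
  rw [eval_map]
  have := eval₂_comp_left Complex.ofRealHom (RingHom.id ℝ) y P
  rw [← eval₂_id]
  simp only [RingHom.comp_id] at this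
  exact this.symm

lemma fC_eval {d : ℕ} (A : Finset (Fin d → ℕ)) (w : (Fin d → ℕ) → ℝ) (u : Fin d → ℝ)
    (g : (Fin d → ℕ) → ℝ) :
    eval (fun i => ((Real.exp (u i) : ℝ) : ℂ))
      (∑ a ∈ A, C ((g a : ℂ)) * (C ((w a : ℂ)) * ∏ i, X i ^ a i)) =
      ((∑ a ∈ A, g a * tW w u a : ℝ) : ℂ) := by
  simp only [map_sum, map_mul, eval_C, map_prod, map_pow, eval_X]
  rw [Complex.ofReal_sum]
  refine Finset.sum_congr rfl fun a _ => ?_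
  rw [tW, Real.exp_sum]
  have : ∀ i, Real.exp ((a i : ℝ) * u i) = Real.exp (u i) ^ a i := fun i => Real.exp_nat_mul _ _
  simp only [this]
  norm_cast

lemma X_mul_pderiv_fC {d : ℕ} (A : Finset (Fin d → ℕ)) (w : (Fin d → ℕ) → ℝ) (i : Fin d) :
    (X i * pderiv i (∑ a ∈ A, C ((w a : ℂ)) * ∏ i, X i ^ a i) : MvPolynomial (Fin d) ℂ) =
      ∑ a ∈ A, C (((a i : ℝ) : ℂ)) * (C ((w a : ℂ)) * ∏ i, X i ^ a i) := by
  rw [map_sum, Finset.mul_sum]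
  refine Finset.sum_congr rfl fun a _ => ?_
  have : (C ((w a : ℂ)) * ∏ i, X i ^ a i : MvPolynomial (Fin d) ℂ) =
      monomial (Finsupp.equivFunOnFinite.symm a) (w a : ℂ) := by
    rw [monomial_eq, Finsupp.prod_fintype _ _ (by simp)]
    rfl
  rw [this, X_mul_pderiv_monomial, nsmul_eq_mul]
  congr 1

theorem toric_patch_rational_linear_precision_iff_toric_differential_birational
    (d : ℕ) (A : Finset (Fin d → ℕ))
    (hdim : affineSpan ℝ ((fun a : Fin d → ℕ => fun i => (a i : ℝ)) '' (A : Set (Fin d → ℕ))) = ⊤)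
    (hprim : AddSubgroup.closure
        {v : Fin d → ℤ | ∃ a ∈ A, ∃ a' ∈ A,
          v = (fun i => (a i : ℤ)) - fun i => (a' i : ℤ)} = (⊤ : AddSubgroup (Fin d → ℤ)))
    (w : (Fin d → ℕ) → ℝ) (hw : ∀ a ∈ A, 0 < w a)
    (fC : MvPolynomial (Fin d) ℂ)
    (hfC : fC = ∑ a ∈ A, C ((w a : ℂ)) * ∏ i, X i ^ a i)
    (ψ : Fin d → FractionRing (MvPolynomial (Fin d) ℂ))
    (hψ : ∀ i, ψ i =
      algebraMap (MvPolynomial (Fin d) ℂ) (FractionRing (MvPolynomial (Fin d) ℂ))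
          (X i * pderiv i fC) /
        algebraMap (MvPolynomial (Fin d) ℂ) (FractionRing (MvPolynomial (Fin d) ℂ)) fC) :
    (∃ p q : Fin d → MvPolynomial (Fin d) ℝ,
      ∀ x ∈ interior (convexHull ℝ
          ((fun a : Fin d → ℕ => fun i => (a i : ℝ)) '' (A : Set (Fin d → ℕ)))),
        (∀ i, eval x (q i) ≠ 0) ∧
        (∀ i, 0 < eval x (p i) / eval x (q i)) ∧
        ∑ a ∈ A, (w a * ∏ i, (eval x (p i) / eval x (q i)) ^ a i) •
            ((fun i => (a i : ℝ)) - x) = 0)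
    ↔ IntermediateField.adjoin ℂ (Set.range ψ) = ⊤ := by
  have hA := A_nonempty hdim
  -- values of `f` and `ψ` at positive real points
  have hev : ∀ u : Fin d → ℝ, eval (fun i => ((Real.exp (u i) : ℝ) : ℂ)) fC = (tZ A w u : ℂ) := by
    intro u
    have := fC_eval A w u (fun _ => 1)
    simpa [hfC, tZ] using this
  have hevne : ∀ u : Fin d → ℝ, eval (fun i => ((Real.exp (u i) : ℝ) : ℂ)) fC ≠ 0 := by
    intro u; rw [hev]; exact_mod_cast (tZ_pos hA hw u).ne'
  have hF : fC ≠ 0 := by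
    intro h; apply hevne 0; rw [h, map_zero]
  have hNe : ∀ (u : Fin d → ℝ), (fun i => eval (fun i => ((Real.exp (u i) : ℝ) : ℂ)) (X i * pderiv i fC) /
      eval (fun i => ((Real.exp (u i) : ℝ) : ℂ)) fC) = fun i => (tΨ A w u i : ℂ) := by
    intro u
    funext i
    rw [hev, hfC, X_mul_pderiv_fC, fC_eval A w u (fun a => (a i : ℝ)), tΨ, Complex.ofReal_div]
  have hclear := clear_denoms fC (fun i => X i * pderiv i fC) hF ψ hψ
  have hF' : algebraMap _ (FractionRing (MvPolynomial (Fin d) ℂ)) fC ≠ 0 := by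
    rwa [Ne, IsFractionRing.to_map_eq_zero_iff]
  -- translate identities between rational functions and identities at positive points
  have htrans : ∀ (P Q : MvPolynomial (Fin d) ℂ) (i : Fin d),
      algebraMap (MvPolynomial (Fin d) ℂ) (FractionRing (MvPolynomial (Fin d) ℂ)) (X i) * aeval ψ Q = aeval ψ P ↔
      ∀ u : Fin d → ℝ, (Real.exp (u i) : ℂ) * eval (fun i => (tΨ A w u i : ℂ)) Q =
        eval (fun i => (tΨ A w u i : ℂ)) P := by
    intro P Q i
    obtain ⟨n, R, hR, hR'⟩ := hclear P
    obtain ⟨m, S, hS, hS'⟩ := hclear Q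
    have h1 : algebraMap (MvPolynomial (Fin d) ℂ) (FractionRing (MvPolynomial (Fin d) ℂ)) (X i) * aeval ψ Q = aeval ψ P ↔
        X i * S * fC ^ n = R * fC ^ m := by
      rw [← (IsFractionRing.injective (MvPolynomial (Fin d) ℂ)
        (FractionRing (MvPolynomial (Fin d) ℂ))).eq_iff]
      simp only [map_mul, map_pow, hR, hS]
      have hp := mul_ne_zero (pow_ne_zero n hF') (pow_ne_zero m hF')
      rw [← mul_right_inj' hp]
      constructor <;> intro h <;> linear_combination h
    have h2 : ∀ u : Fin d → ℝ, ((Real.exp (u i) : ℂ) * eval (fun i => (tΨ A w u i : ℂ)) Q =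
        eval (fun i => (tΨ A w u i : ℂ)) P) ↔
        eval (fun i => ((Real.exp (u i) : ℝ) : ℂ)) (X i * S * fC ^ n) =
        eval (fun i => ((Real.exp (u i) : ℝ) : ℂ)) (R * fC ^ m) := by
      intro u
      have hRu := hR' _ (hevne u)
      have hSu := hS' _ (hevne u)
      rw [hNe] at hRu hSu
      simp only [map_mul, map_pow, hRu, hSu, eval_X]
      have hp := mul_ne_zero (pow_ne_zero n (hevne u)) (pow_ne_zero m (hevne u))
      rw [← mul_right_inj' hp]
      constructor <;> intro h <;> linear_combination h
    rw [h1]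
    simp only [h2]
    constructor
    · intro h u; rw [h]
    · intro h
      refine MvPolynomial.funext_set (fun _ => (fun t : ℝ => ((Real.exp t : ℝ) : ℂ)) '' Set.univ)
        (fun _ => ?_) ?_
      · refine Set.Infinite.image ?_ Set.infinite_univ
        intro s _ t _ hst
        exact Real.exp_injective (Complex.ofReal_injective hst)
      · intro x hx
        choose u _ hu using fun i => hx i (Set.mem_univ i)
        have : x = fun i => ((Real.exp (u i) : ℝ) : ℂ) := funext fun i => (hu i).symm
        rw [this]; exact h u
  -- the linear precision identity at a positive point
  have hLP : ∀ u y : Fin d → ℝ, (∑ a ∈ A, (w a * ∏ i, Real.exp (u i) ^ a i) •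
      ((fun i => (a i : ℝ)) - y) = 0) ↔ tΨ A w u = y := by
    intro u y
    rw [tΨ_eq_iff hdim hw, _root_.funext_iff]
    refine forall_congr' fun i => ?_
    rw [Finset.sum_apply]
    have : ∀ a : Fin d → ℕ, w a * ∏ i, Real.exp (u i) ^ a i = tW w u a := by
      intro a
      rw [tW, Real.exp_sum]
      simp only [Real.exp_nat_mul]
    simp only [this, Pi.smul_apply, Pi.sub_apply, smul_eq_mul, Pi.zero_apply]
  constructor
  · rintro ⟨p, q, hpq⟩
    have hmem : ∀ i, algebraMap (MvPolynomial (Fin d) ℂ) (FractionRing (MvPolynomial (Fin d) ℂ)) (X i) ∈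
        IntermediateField.adjoin ℂ (Set.range ψ) := by
      intro i
      have hu : ∀ u, eval (tΨ A w u) (q i) ≠ 0 ∧
          Real.exp (u i) * eval (tΨ A w u) (q i) = eval (tΨ A w u) (p i) := by
        intro u
        obtain ⟨h1, h2, h3⟩ := hpq _ (tΨ_mem_interior hdim hw u)
        refine ⟨h1 i, ?_⟩
        set v : Fin d → ℝ := fun i => Real.log (eval (tΨ A w u) (p i) / eval (tΨ A w u) (q i))
          with hv
        have hexp : ∀ i, Real.exp (v i) = eval (tΨ A w u) (p i) / eval (tΨ A w u) (q i) :=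
          fun i => Real.exp_log (h2 i)
        simp only [← hexp] at h3
        have := tΨ_injective hdim hw ((hLP _ _).1 h3)
        rw [← this, hexp, this, div_mul_cancel₀ _ (h1 i)]
      have hid := (htrans (map Complex.ofRealHom (p i)) (map Complex.ofRealHom (q i)) i).2 (by
        intro u
        rw [eval_map_ofReal, eval_map_ofReal, ← (hu u).2]; push_cast; ring)
      rw [IntermediateField.mem_adjoin_range_iff]
      refine ⟨map Complex.ofRealHom (p i), map Complex.ofRealHom (q i), ?_⟩
      rw [eq_div_iff, hid]
      intro h0
      have h1 : aeval ψ (map Complex.ofRealHom (p i)) = 0 := by rw [← hid, h0, mul_zero]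
      obtain ⟨m, S, hS, hS'⟩ := hclear (map Complex.ofRealHom (q i))
      rw [h0, mul_zero, IsFractionRing.to_map_eq_zero_iff] at hS
      have h2 := hS' _ (hevne 0)
      rw [hS, map_zero, hNe, eval_map_ofReal] at h2
      have h3 := (mul_eq_zero.1 h2.symm).resolve_left (pow_ne_zero _ (hevne 0))
      exact (hu 0).1 (by exact_mod_cast h3)
    have hpoly : ∀ R : MvPolynomial (Fin d) ℂ,
        algebraMap _ (FractionRing (MvPolynomial (Fin d) ℂ)) R ∈
        IntermediateField.adjoin ℂ (Set.range ψ) := by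
      intro R
      induction R using MvPolynomial.induction_on with
      | C a =>
        rw [← MvPolynomial.algebraMap_eq, ← IsScalarTower.algebraMap_apply]
        exact IntermediateField.algebraMap_mem _ a
      | add p q hp hq => rw [map_add]; exact add_mem hp hq
      | mul_X p i hp => rw [map_mul]; exact mul_mem hp (hmem i)
    rw [eq_top_iff]
    intro x _
    obtain ⟨a, b, _, rfl⟩ := IsFractionRing.div_surjective (A := MvPolynomial (Fin d) ℂ) x
    exact div_mem (hpoly a) (hpoly b)
  · intro htop
    have hone : ∀ i, ∃ p q : MvPolynomial (Fin d) ℝ, ∀ u,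
        eval (tΨ A w u) q ≠ 0 ∧ eval (tΨ A w u) q * Real.exp (u i) = eval (tΨ A w u) p := by
      intro i
      have hmem : algebraMap (MvPolynomial (Fin d) ℂ) (FractionRing (MvPolynomial (Fin d) ℂ)) (X i) ∈
          IntermediateField.adjoin ℂ (Set.range ψ) := by rw [htop]; trivial
      rw [IntermediateField.mem_adjoin_range_iff] at hmem
      obtain ⟨P, Q, hPQ⟩ := hmem
      have hX : algebraMap (MvPolynomial (Fin d) ℂ) (FractionRing (MvPolynomial (Fin d) ℂ)) (X i) ≠ 0 := by
        rw [Ne, IsFractionRing.to_map_eq_zero_iff]; exact X_ne_zero i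
      have hQ0 : aeval ψ Q ≠ 0 := by
        intro h; rw [h, div_zero] at hPQ; exact hX hPQ
      have hid := (htrans P Q i).1 (by rw [hPQ, div_mul_cancel₀ _ hQ0])
      have hreal : ∃ P' Q' : MvPolynomial (Fin d) ℝ, Q' ≠ 0 ∧ ∀ u,
          eval (tΨ A w u) Q' * Real.exp (u i) = eval (tΨ A w u) P' := by
        obtain ⟨P₁, P₂, rfl⟩ := complex_split P
        obtain ⟨Q₁, Q₂, rfl⟩ := complex_split Q
        have hboth : ∀ u, eval (tΨ A w u) Q₁ * Real.exp (u i) = eval (tΨ A w u) P₁ ∧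
            eval (tΨ A w u) Q₂ * Real.exp (u i) = eval (tΨ A w u) P₂ := by
          intro u
          have h := hid u
          simp only [map_add, map_mul, eval_C, eval_map_ofReal] at h
          have hre := congrArg Complex.re h
          have him := congrArg Complex.im h
          simp only [Complex.mul_re, Complex.mul_im, Complex.add_re, Complex.add_im,
            Complex.ofReal_re, Complex.ofReal_im, Complex.I_re, Complex.I_im] at hre him
          exact ⟨by linarith, by linarith⟩
        by_cases h1 : Q₁ = 0
        · refine ⟨P₂, Q₂, ?_, fun u => (hboth u).2⟩
          rintro rfl
          apply hQ0; simp [h1]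
        · exact ⟨P₁, Q₁, h1, fun u => (hboth u).1⟩
      obtain ⟨P', Q', hQ', hPQ'⟩ := hreal
      obtain ⟨q, p, c, hrel, hcq, hcp⟩ :=
        UniqueFactorizationMonoid.exists_reduced_factors Q' hQ' P'
      have hc : c ≠ 0 := by rintro rfl; apply hQ'; rw [← hcq, zero_mul]
      refine ⟨p, q, fun u => ?_⟩
      obtain ⟨φ, hφ, hφu, hφe⟩ := tΨ_localInverse hdim hw u
      have := reduced_pt p q c hrel hc (fun y => Real.exp (φ y i)) (tΨ A w u) (hφ i) (by
        filter_upwards [hφe] with y hy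
        have := hPQ' (φ y)
        rwa [hy, ← hcq, ← hcp] at this)
      simpa only [hφu] using this
    choose p q hpq using hone
    refine ⟨p, q, fun y hy => ?_⟩
    obtain ⟨u, rfl⟩ := tΨ_surj hdim hw y hy
    have hdiv : ∀ i, eval (tΨ A w u) (p i) / eval (tΨ A w u) (q i) = Real.exp (u i) := by
      intro i
      rw [div_eq_iff (hpq i u).1, ← (hpq i u).2, mul_comm]
    refine ⟨fun i => (hpq i u).1, fun i => ?_, ?_⟩
    · rw [hdiv]; exact Real.exp_pos _
    · simp only [hdiv]
      exact (hLP u _).2 rfl
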